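/- Let N be a norm on ℝ² whose restriction to ℝ² \ {0} is of class C^{2,δ} (δ ∈ (0,1)) with everywhere strictly positive curvature of the N-unit circle, and let Π : ℝ × ℝ² → ℝ, J, Ω be as in the context. Assume: (P1) Π is bounded on cl(J) × Ω; (P2) there are δ ∈ (0,1) and C_δ > 0 with |∂_t Π(t₁, x) − ∂_t Π(t₂, x)| ≤ C_δ |t₁ − t₂|^δ for all x ∈ Ω and t₁, t₂ ∈ cl(J); and (P3) whenever Π(t, x) = 0 for some t ∈ cl(J) and x with N(x) = 1, then ∂_t Π(t, x) ≠ 0. Then transversality holds on J: there exists C > 0 such that for all distinct x, y ∈ Ω and all t ∈ J, if |Φ_t(x,y)| ≤ C then |d/dt Φ_t(x,y)| ≥ C, where Φ_t(x,y) = (Π(t,x) − Π(t,y))/N(x − y); moreover ∂_t Π is bounded on compact subintervals of J times Ω and δ-Hölder in t, and |d/dt Φ_t(x,y)| is bounded and δ-Hölder in t whenever |Φ_{t₁}(x,y)| + |Φ_{t₂}(x,y)| ≤ C. -/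

import Mathlib

open Set Metric Real
open scoped RealInnerProductSpace

noncomputable section

/-- The point `(a, b)` of the Euclidean plane. -/
def mk2 (a b : ℝ) : EuclideanSpace ℝ (Fin 2) :=
  (WithLp.equiv 2 (Fin 2 → ℝ)).symm ![a, b]

/-- The direction `v(t) = (cos t, sin t) ∈ S¹`. -/
def vdir (t : ℝ) : EuclideanSpace ℝ (Fin 2) :=
  mk2 (Real.cos t) (Real.sin t)

/-- `R v(t) = (−sin t, cos t)`, the rotation of `v(t)` by `π/2`. -/
def Rvdir (t : ℝ) : EuclideanSpace ℝ (Fin 2) :=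
  mk2 (-Real.sin t) (Real.cos t)

/-- The scalar projection family `Π(t,x) = ⟪P_{v(t)}(x), R v(t)⟫` associated with
a family `P` of closest-point projections. -/
def scalarProj (P : EuclideanSpace ℝ (Fin 2) → EuclideanSpace ℝ (Fin 2) → EuclideanSpace ℝ (Fin 2))
    (t : ℝ) (x : EuclideanSpace ℝ (Fin 2)) : ℝ :=
  ⟪P (vdir t) x, Rvdir t⟫

/-- `Φ_t(x,y) = (Π(t,x) − Π(t,y)) / N(x − y)`. -/
def projQuot (N : EuclideanSpace ℝ (Fin 2) → ℝ)
    (P : EuclideanSpace ℝ (Fin 2) → EuclideanSpace ℝ (Fin 2) → EuclideanSpace ℝ (Fin 2))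
    (t : ℝ) (x y : EuclideanSpace ℝ (Fin 2)) : ℝ :=
  (scalarProj P t x - scalarProj P t y) / N (x - y)

local notation "ℝ²" => EuclideanSpace ℝ (Fin 2)

lemma inner_plane (x y : ℝ²) : ⟪x, y⟫ = x 0 * y 0 + x 1 * y 1 := by
  simp [PiLp.inner_apply, Fin.sum_univ_two, mul_comm]

@[simp] lemma mk2_zero (a b : ℝ) : mk2 a b 0 = a := rfl

@[simp] lemma mk2_one (a b : ℝ) : mk2 a b 1 = b := rfl

lemma inner_vdir (t : ℝ) (x : ℝ²) :
    ⟪vdir t, x⟫ = Real.cos t * x 0 + Real.sin t * x 1 := by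
  simp [inner_plane, vdir]

lemma inner_Rvdir (t : ℝ) (x : ℝ²) :
    ⟪x, Rvdir t⟫ = -Real.sin t * x 0 + Real.cos t * x 1 := by
  simp [inner_plane, Rvdir, mul_comm]

lemma norm_vdir (t : ℝ) : ‖vdir t‖ = 1 := by
  simp [EuclideanSpace.norm_eq, Fin.sum_univ_two, vdir]

lemma vdir_mem_sphere (t : ℝ) : vdir t ∈ sphere (0 : ℝ²) 1 := by
  simp [norm_vdir]

lemma inner_vdir_Rvdir (t : ℝ) : ⟪vdir t, Rvdir t⟫ = 0 := by
  rw [inner_vdir]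
  simp [Rvdir]
  ring

lemma norm_pos_of_ne_zero {N : ℝ² → ℝ}
    (hN_add : ∀ x y : ℝ², N (x + y) ≤ N x + N y)
    (hN_smul : ∀ (c : ℝ) (x : ℝ²), N (c • x) = |c| * N x)
    (hN_zero : ∀ x : ℝ², N x = 0 → x = 0) {x : ℝ²} (hx : x ≠ 0) : 0 < N x := by
  refine lt_of_le_of_ne ?_ fun h => hx (hN_zero x h.symm)
  have h0 : N 0 = 0 := by simpa using hN_smul 0 0
  have h := hN_add x ((-1 : ℝ) • x)
  rw [hN_smul] at h
  simp only [neg_smul, one_smul, add_neg_cancel, h0, abs_neg, abs_one, one_mul] at h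
  linarith

/-- In the plane, two vectors orthogonal to a common nonzero vector are parallel. -/
lemma eq_smul_of_inner_eq_zero {v d e : ℝ²} (hv : v ≠ 0) (hd : d ≠ 0)
    (hvd : ⟪v, d⟫ = 0) (hve : ⟪v, e⟫ = 0) : e = (⟪e, d⟫ / ⟪d, d⟫) • d := by
  have hdd : ⟪d, d⟫ ≠ 0 := inner_self_ne_zero.mpr hd
  have hvv : ⟪v, v⟫ ≠ 0 := inner_self_ne_zero.mpr hv
  simp only [inner_plane] at *
  have key : e 0 * d 1 = e 1 * d 0 := by
    apply mul_left_cancel₀ hvv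
    linear_combination (v 0 * d 1 - v 1 * d 0) * hve - (v 0 * e 1 - v 1 * e 0) * hvd
  ext i
  fin_cases i
  · simp only [Fin.zero_eta, PiLp.smul_apply, smul_eq_mul]
    rw [div_mul_eq_mul_div, eq_div_iff hdd]
    linear_combination d 1 * key
  · simp only [Fin.mk_one, PiLp.smul_apply, smul_eq_mul]
    rw [div_mul_eq_mul_div, eq_div_iff hdd]
    linear_combination -d 0 * key

/-- A `C²` unit-speed plane curve with nonvanishing second derivative is nowhere locally
contained in a line. -/
lemma not_eventually_inner_eq {γ : ℝ → ℝ²} (hγ : ContDiff ℝ 2 γ)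
    (hunit : ∀ t, ‖deriv γ t‖ = 1) (hcurv : ∀ t, deriv (deriv γ) t ≠ 0)
    {v : ℝ²} (hv : v ≠ 0) (k t₀ : ℝ) : ¬ ∀ᶠ t in nhds t₀, ⟪v, γ t⟫ = k := by
  intro h
  have hd1 : Differentiable ℝ γ := hγ.differentiable (by norm_num)
  have hd2 : Differentiable ℝ (deriv γ) := by
    have : ContDiff ℝ 1 (deriv γ) := (contDiff_succ_iff_deriv (n := 1)).mp
      (by simpa [one_add_one_eq_two] using hγ) |>.2.2
    exact this.differentiable (by norm_num)
  have h1 : ∀ᶠ t in nhds t₀, ⟪v, deriv γ t⟫ = 0 := by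
    filter_upwards [h.eventually_nhds] with t ht
    have e1 : HasDerivAt (fun s => ⟪v, γ s⟫) ⟪v, deriv γ t⟫ t := by
      simpa using (hasDerivAt_const t v).inner ℝ (hd1 t).hasDerivAt
    have e2 : HasDerivAt (fun s => ⟪v, γ s⟫) 0 t :=
      (hasDerivAt_const t k).congr_of_eventuallyEq ht
    exact e1.unique e2
  have h2 : ⟪v, deriv (deriv γ) t₀⟫ = 0 := by
    have e1 : HasDerivAt (fun s => ⟪v, deriv γ s⟫) ⟪v, deriv (deriv γ) t₀⟫ t₀ := by
      simpa using (hasDerivAt_const t₀ v).inner ℝ (hd2 t₀).hasDerivAt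
    have e2 : HasDerivAt (fun s => ⟪v, deriv γ s⟫) 0 t₀ :=
      (hasDerivAt_const t₀ (0 : ℝ)).congr_of_eventuallyEq h1
    exact e1.unique e2
  have h3 : ⟪deriv (deriv γ) t₀, deriv γ t₀⟫ = 0 := by
    have e1 := (hd2 t₀).hasDerivAt.inner ℝ (hd2 t₀).hasDerivAt
    have e2 : HasDerivAt (fun s => ⟪deriv γ s, deriv γ s⟫) 0 t₀ := by
      simp only [real_inner_self_eq_norm_sq, hunit]
      exact hasDerivAt_const _ _
    have e3 := e1.unique e2
    rw [real_inner_comm] at e3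
    linarith
  have hne : deriv γ t₀ ≠ 0 := by
    intro h0
    have := hunit t₀
    simp [h0] at this
  apply hcurv t₀
  rw [eq_smul_of_inner_eq_zero hv hne h1.self_of_nhds h2, h3]
  simp

/-- If the unit circle of `N` is positively curved, then `N` has at most one minimizer on any
affine line. -/
lemma eq_of_isMinimizer {N : ℝ² → ℝ}
    (hN_add : ∀ x y : ℝ², N (x + y) ≤ N x + N y)
    (hN_smul : ∀ (c : ℝ) (x : ℝ²), N (c • x) = |c| * N x)
    (hN_zero : ∀ x : ℝ², N x = 0 → x = 0)
    {γ : ℝ → ℝ²} (hγ : ContDiff ℝ 2 γ) (hγ_range : range γ = {x : ℝ² | N x = 1})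
    (hunit : ∀ t, ‖deriv γ t‖ = 1) (hcurv : ∀ t, deriv (deriv γ) t ≠ 0)
    {v y₁ y₂ : ℝ²} (hv : v ≠ 0) (hy : ⟪v, y₂⟫ = ⟪v, y₁⟫)
    (h₁ : ∀ q, ⟪v, q⟫ = ⟪v, y₁⟫ → N y₁ ≤ N q)
    (h₂ : ∀ q, ⟪v, q⟫ = ⟪v, y₁⟫ → N y₂ ≤ N q) : y₁ = y₂ := by
  by_contra hne
  have h0 : N 0 = 0 := by simpa using hN_smul 0 0
  have hN12 : N y₂ = N y₁ := le_antisymm (h₂ _ rfl) (h₁ _ hy)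
  have hpos : 0 < N y₁ := by
    refine norm_pos_of_ne_zero hN_add hN_smul hN_zero fun h => hne ?_
    rw [h, hN_zero y₂ (by rw [hN12, h, h0])]
  have hs : ⟪v, y₁⟫ ≠ 0 := by
    intro h
    have := h₁ 0 (by simp [h])
    linarith
  set n := N y₁ with hn
  set s := ⟪v, y₁⟫ with hsdef
  set d := y₂ - y₁ with hd
  have hd0 : d ≠ 0 := sub_ne_zero.mpr (Ne.symm hne)
  have hvd : ⟪v, d⟫ = 0 := by rw [hd, inner_sub_right, hy, sub_self]
  have hdd : ⟪d, d⟫ ≠ 0 := inner_self_ne_zero.mpr hd0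
  have hseg : ∀ l ∈ Ioo (0 : ℝ) 1, N (y₁ + l • d) = n := by
    intro l hl
    apply le_antisymm
    · have : y₁ + l • d = (1 - l) • y₁ + l • y₂ := by rw [hd]; module
      rw [this]
      refine (hN_add _ _).trans_eq ?_
      rw [hN_smul, hN_smul, hN12, abs_of_pos hl.1, abs_of_pos (by linarith [hl.2])]
      ring
    · exact h₁ _ (by rw [inner_add_right, inner_smul_right, hvd]; simp [hsdef])
  have hhalf : N (y₁ + (1 / 2 : ℝ) • d) = n := hseg _ (by norm_num)
  obtain ⟨t₀, ht₀⟩ : n⁻¹ • (y₁ + (1 / 2 : ℝ) • d) ∈ range γ := by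
    rw [hγ_range, mem_ofPred_eq, hN_smul, hhalf, abs_of_pos (inv_pos.mpr hpos),
      inv_mul_cancel₀ hpos.ne']
  apply not_eventually_inner_eq hγ hunit hcurv hv (s / n) t₀
  have hγc : Continuous γ := hγ.continuous
  have hvγ : ⟪v, γ t₀⟫ = s / n := by
    rw [ht₀, inner_smul_right, inner_add_right, inner_smul_right, hvd]
    simp [← hsdef]
    field_simp
  set c : ℝ → ℝ := fun t => ⟪v, γ t⟫ / s with hc
  have hcc : Continuous c := by fun_prop
  have hc0 : c t₀ = n⁻¹ := by simp only [hc, hvγ]; field_simp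
  have hcpos : ∀ᶠ t in nhds t₀, 0 < c t :=
    hcc.continuousAt.eventually_mem (Ioi_mem_nhds (by rw [hc0]; positivity))
  set l : ℝ → ℝ := fun t => ⟪(c t)⁻¹ • γ t - y₁, d⟫ / ⟪d, d⟫ with hl
  have hl0 : l t₀ = 1 / 2 := by
    simp only [hl, hc0, ht₀]
    rw [smul_smul, inv_inv, mul_inv_cancel₀ hpos.ne', one_smul, add_sub_cancel_left,
      real_inner_smul_left]
    field_simp
  have hlc : ContinuousAt l t₀ := by
    have : ContinuousAt (fun t => (c t)⁻¹) t₀ :=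
      hcc.continuousAt.inv₀ (by rw [hc0]; positivity)
    have : ContinuousAt (fun t => (c t)⁻¹ • γ t - y₁) t₀ :=
      (this.smul hγc.continuousAt).sub continuousAt_const
    exact (this.inner continuousAt_const).div_const _
  have hlmem : ∀ᶠ t in nhds t₀, l t ∈ Ioo (0 : ℝ) 1 :=
    hlc.eventually_mem (Ioo_mem_nhds (by rw [hl0]; norm_num) (by rw [hl0]; norm_num))
  filter_upwards [hcpos, hlmem] with t hct hlt
  have hw : (c t)⁻¹ • γ t - y₁ = l t • d := by
    refine eq_smul_of_inner_eq_zero hv hd0 hvd ?_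
    have hin : ⟪v, γ t⟫ = c t * s := by simp only [hc]; field_simp
    rw [inner_sub_right, inner_smul_right, hin, ← hsdef, inv_mul_cancel_left₀ hct.ne', sub_self]
  have hγt : γ t = c t • (y₁ + l t • d) := by
    rw [← hw, add_sub_cancel, smul_smul, mul_inv_cancel₀ hct.ne', one_smul]
  have hN1 : N (γ t) = 1 := by
    have : γ t ∈ range γ := mem_range_self t
    rwa [hγ_range] at this
  rw [hγt, hN_smul, hseg _ hlt, abs_of_pos hct] at hN1
  have : ⟪v, γ t⟫ = c t * s := by simp only [hc]; field_simp
  rw [this, eq_div_iff hpos.ne']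
  linear_combination s * hN1

/-- The closest-point projection for a norm with positively curved unit circle is determined by
its value at the normal direction. -/
lemma sub_closestPoint_eq {N : ℝ² → ℝ}
    (hN_add : ∀ x y : ℝ², N (x + y) ≤ N x + N y)
    (hN_smul : ∀ (c : ℝ) (x : ℝ²), N (c • x) = |c| * N x)
    (hN_zero : ∀ x : ℝ², N x = 0 → x = 0)
    {γ : ℝ → ℝ²} (hγ : ContDiff ℝ 2 γ) (hγ_range : range γ = {x : ℝ² | N x = 1})
    (hunit : ∀ t, ‖deriv γ t‖ = 1) (hcurv : ∀ t, deriv (deriv γ) t ≠ 0)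
    {v : ℝ²} (hv : ‖v‖ = 1) {p : ℝ² → ℝ²}
    (hp : ∀ x, ⟪v, p x⟫ = 0 ∧ ∀ q, ⟪v, q⟫ = 0 → N (x - p x) ≤ N (x - q)) (x : ℝ²) :
    x - p x = ⟪v, x⟫ • (v - p v) := by
  have hvv : ⟪v, v⟫ = 1 := by rw [real_inner_self_eq_norm_sq, hv, one_pow]
  have hmin : ∀ x q, ⟪v, q⟫ = ⟪v, x⟫ → N (x - p x) ≤ N q := by
    intro x q hq
    simpa using (hp x).2 (x - q) (by rw [inner_sub_right, hq, sub_self])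
  have hx : ⟪v, x - p x⟫ = ⟪v, x⟫ := by rw [inner_sub_right, (hp x).1, sub_zero]
  have hv0 : v ≠ 0 := by
    rintro rfl
    simp at hv
  refine eq_of_isMinimizer hN_add hN_smul hN_zero hγ hγ_range hunit hcurv hv0 ?_ ?_ ?_
  · rw [inner_smul_right, hx, inner_sub_right, (hp v).1, hvv, sub_zero, mul_one]
  · intro q hq
    exact hmin x q (hq.trans hx)
  · intro q hq
    rw [hx] at hq
    by_cases hs : ⟪v, x⟫ = 0
    · have h0 : p 0 = 0 := by
        by_contra h
        have h1 := hmin 0 0 rfl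
        have h2 := norm_pos_of_ne_zero hN_add hN_smul hN_zero (x := 0 - p 0) (by simpa using h)
        have h3 : N 0 = 0 := by simpa using hN_smul 0 0
        linarith
      have := hmin 0 q (by simp [hq, hs])
      rw [hs, zero_smul]
      simpa [h0] using this
    · have h := hmin v (⟪v, x⟫⁻¹ • q) (by
        rw [inner_smul_right, hq, hvv, inv_mul_cancel₀ hs])
      rw [hN_smul, abs_inv, le_inv_mul_iff₀ (abs_pos.mpr hs)] at h
      rwa [hN_smul]

lemma continuousOn_of_abs_sub_le_rpow {f : ℝ → ℝ} {s : Set ℝ} {C δ : ℝ} (hδ : 0 < δ)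
    (h : ∀ x ∈ s, ∀ y ∈ s, |f x - f y| ≤ C * |x - y| ^ δ) : ContinuousOn f s := by
  intro t ht
  rw [ContinuousWithinAt, tendsto_iff_norm_sub_tendsto_zero]
  refine squeeze_zero' (g := fun x => C * |x - t| ^ δ) (.of_forall fun _ => norm_nonneg _)
    (eventually_mem_nhdsWithin.mono fun x hx => h x hx t ht) ?_
  have : Continuous fun x : ℝ => C * |x - t| ^ δ :=
    continuous_const.mul ((continuous_abs.comp (continuous_sub_right t)).rpow_const
      fun _ => Or.inr hδ.le)
  simpa [hδ.ne'] using (this.tendsto t).mono_left nhdsWithin_le_nhds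

/-- under the standing assumptions, if `Π` satisfies (P1), (P2),
(P3) on `cl(J) × Ω`, then transversality and the regularity conditions (a), (c)
of Peres–Schlag hold on `J`. -/
theorem transversality_of_P1_P2_P3
    (N : EuclideanSpace ℝ (Fin 2) → ℝ)
    (hN_add : ∀ x y : EuclideanSpace ℝ (Fin 2), N (x + y) ≤ N x + N y)
    (hN_smul : ∀ (c : ℝ) (x : EuclideanSpace ℝ (Fin 2)), N (c • x) = |c| * N x)
    (hN_zero : ∀ x : EuclideanSpace ℝ (Fin 2), N x = 0 → x = 0)
    -- `N` restricted to `ℝ² \ {0}` is of class `C^{2,δ}` for some `δ ∈ (0,1)`: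
    (δ : ℝ) (hδ0 : 0 < δ) (hδ1 : δ < 1)
    (hN_C2 : ContDiffOn ℝ 2 N ({0}ᶜ : Set (EuclideanSpace ℝ (Fin 2))))
    (hN_holder : ∀ K : Set (EuclideanSpace ℝ (Fin 2)), K ⊆ {0}ᶜ → IsCompact K →
      ∃ M : ℝ, ∀ x ∈ K, ∀ y ∈ K,
        ‖iteratedFDerivWithin ℝ 2 N ({0}ᶜ : Set (EuclideanSpace ℝ (Fin 2))) x -
          iteratedFDerivWithin ℝ 2 N ({0}ᶜ : Set (EuclideanSpace ℝ (Fin 2))) y‖ ≤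
            M * ‖x - y‖ ^ δ)
    -- strictly positive curvature of the `N`-unit circle:
    (γ : ℝ → EuclideanSpace ℝ (Fin 2)) (L : ℝ) (hL : 0 < L)
    (hγ_C2 : ContDiff ℝ 2 γ)
    (hγ_per : ∀ t, γ (t + L) = γ t)
    (hγ_range : Set.range γ = {x : EuclideanSpace ℝ (Fin 2) | N x = 1})
    (hγ_unit : ∀ t, ‖deriv γ t‖ = 1)
    (hγ_curv : ∀ t, deriv (deriv γ) t ≠ 0)
    -- `P v` is the closest-point projection (w.r.t. `N`) onto `H_v`:
    (P : EuclideanSpace ℝ (Fin 2) → EuclideanSpace ℝ (Fin 2) → EuclideanSpace ℝ (Fin 2))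
    (hP : ∀ v ∈ sphere (0 : EuclideanSpace ℝ (Fin 2)) 1, ∀ x : EuclideanSpace ℝ (Fin 2),
      ⟪v, P v x⟫ = 0 ∧
        ∀ q : EuclideanSpace ℝ (Fin 2), ⟪v, q⟫ = 0 → N (x - P v x) ≤ N (x - q))
    -- `J = (a,b)` a bounded open interval, `Ω` a closed ball centered at `0`:
    (a b : ℝ) (hab : a < b) (r : ℝ) (hr : 0 < r)
    -- (P1) `Π` is bounded on `cl(J) × Ω`:
    (hP1 : ∃ M : ℝ, ∀ t ∈ Icc a b, ∀ x ∈ closedBall (0 : EuclideanSpace ℝ (Fin 2)) r,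
      |scalarProj P t x| ≤ M)
    -- (P2) `∂ₜΠ` is `δ`-Hölder in `t`, uniformly on `cl(J) × Ω`:
    (hP2 : ∃ Cδ : ℝ, 0 < Cδ ∧ ∀ x ∈ closedBall (0 : EuclideanSpace ℝ (Fin 2)) r,
      ∀ t₁ ∈ Icc a b, ∀ t₂ ∈ Icc a b,
        |deriv (fun s => scalarProj P s x) t₁ - deriv (fun s => scalarProj P s x) t₂| ≤
          Cδ * |t₁ - t₂| ^ δ)
    -- (P3) whenever `Π(t,x) = 0` with `t ∈ cl(J)` and `N x = 1`, then `∂ₜΠ(t,x) ≠ 0`: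
    (hP3 : ∀ t ∈ Icc a b, ∀ x : EuclideanSpace ℝ (Fin 2), N x = 1 →
      scalarProj P t x = 0 → deriv (fun s => scalarProj P s x) t ≠ 0) :
    -- (a) `C^{1,δ}`-regularity of `Π` on compact subintervals of `J`:
    (∀ I : Set ℝ, I ⊆ Ioo a b → IsCompact I →
      ∃ CI : ℝ, 0 < CI ∧
        (∀ t ∈ I, ∀ x ∈ closedBall (0 : EuclideanSpace ℝ (Fin 2)) r,
          |deriv (fun s => scalarProj P s x) t| ≤ CI) ∧
        (∀ x ∈ closedBall (0 : EuclideanSpace ℝ (Fin 2)) r, ∀ t₁ ∈ I, ∀ t₂ ∈ I,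
          |deriv (fun s => scalarProj P s x) t₁ - deriv (fun s => scalarProj P s x) t₂| ≤
            CI * |t₁ - t₂| ^ δ)) ∧
    -- (b) transversality on `J`, and (c) `(1,δ)`-regularity of `Φ`:
    (∃ C : ℝ, 0 < C ∧
      (∀ x ∈ closedBall (0 : EuclideanSpace ℝ (Fin 2)) r,
        ∀ y ∈ closedBall (0 : EuclideanSpace ℝ (Fin 2)) r, x ≠ y →
          ∀ t ∈ Ioo a b, |projQuot N P t x y| ≤ C →
            C ≤ |deriv (fun s => projQuot N P s x y) t|) ∧
      (∃ Ct : ℝ, 0 < Ct ∧ ∃ Cδ : ℝ, 0 < Cδ ∧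
        ∀ x ∈ closedBall (0 : EuclideanSpace ℝ (Fin 2)) r,
          ∀ y ∈ closedBall (0 : EuclideanSpace ℝ (Fin 2)) r, x ≠ y →
            ∀ t₁ ∈ Ioo a b, ∀ t₂ ∈ Ioo a b,
              |projQuot N P t₁ x y| + |projQuot N P t₂ x y| ≤ C →
                |deriv (fun s => projQuot N P s x y) t₁| ≤ Ct ∧
                |deriv (fun s => projQuot N P s x y) t₁ -
                    deriv (fun s => projQuot N P s x y) t₂| ≤ Cδ * |t₁ - t₂| ^ δ)) := by
  have hN_pos : ∀ x, x ≠ 0 → 0 < N x := fun x hx =>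
    norm_pos_of_ne_zero hN_add hN_smul hN_zero hx
  have hproj : ∀ t x, scalarProj P t x =
      (-Real.sin t * x 0 + Real.cos t * x 1) +
        (Real.cos t * x 0 + Real.sin t * x 1) * scalarProj P t (vdir t) := by
    intro t x
    have h := sub_closestPoint_eq hN_add hN_smul hN_zero hγ_C2 hγ_range hγ_unit hγ_curv
      (norm_vdir t) (hP _ (vdir_mem_sphere t)) x
    have h' : P (vdir t) x = x - ⟪vdir t, x⟫ • (vdir t - P (vdir t) (vdir t)) := by
      rw [← h, sub_sub_cancel]
    simp only [scalarProj]
    rw [h', inner_sub_left, real_inner_smul_left, inner_sub_left, inner_vdir_Rvdir,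
      inner_Rvdir, inner_vdir]
    ring
  set μ : ℝ → ℝ := fun t => scalarProj P t (vdir t) with hμ
  have hμd : ∀ t ∈ Icc a b, DifferentiableAt ℝ μ t := by
    intro t ht
    set w := vdir t - P (vdir t) (vdir t) with hw
    have hPv := (hP _ (vdir_mem_sphere t) (vdir t)).1
    have hvw : ⟪vdir t, w⟫ = 1 := by
      rw [hw, inner_sub_right, hPv, real_inner_self_eq_norm_sq, norm_vdir]
      norm_num
    have hwR : ⟪w, Rvdir t⟫ = -μ t := by
      rw [hw, inner_sub_left, inner_vdir_Rvdir, zero_sub]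
      rfl
    have hw0 : w ≠ 0 := by
      intro h
      simp [h] at hvw
    have hNw : 0 < N w := hN_pos w hw0
    set x := (N w)⁻¹ • w with hx
    have hNx : N x = 1 := by rw [hx, hN_smul, abs_of_pos (inv_pos.mpr hNw), inv_mul_cancel₀ hNw.ne']
    have hvx : ⟪vdir t, x⟫ ≠ 0 := by
      rw [hx, inner_smul_right, hvw, mul_one]
      exact inv_ne_zero hNw.ne'
    have hzero : scalarProj P t x = 0 := by
      rw [hproj, ← inner_vdir, ← inner_Rvdir, hx, inner_smul_right, real_inner_smul_left, hvw, hwR]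
      ring
    have hdiff : DifferentiableAt ℝ (fun s => scalarProj P s x) t := by
      by_contra h
      exact hP3 t ht x hNx hzero (deriv_zero_of_not_differentiableAt h)
    rw [inner_vdir] at hvx
    have hev : μ =ᶠ[nhds t] fun s => (scalarProj P s x - (-Real.sin s * x 0 + Real.cos s * x 1)) /
        (Real.cos s * x 0 + Real.sin s * x 1) := by
      have hc : ContinuousAt (fun s => Real.cos s * x 0 + Real.sin s * x 1) t := by fun_prop
      filter_upwards [hc.eventually_ne hvx] with s hs
      rw [eq_div_iff hs, hproj]
      ring
    refine DifferentiableAt.congr_of_eventuallyEq ?_ hev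
    exact (hdiff.sub (by fun_prop)).div (by fun_prop) hvx
  obtain ⟨p, q, hpq, hpd, hqd⟩ : ∃ p q : ℝ → ℝ,
      (∀ t x, scalarProj P t x = p t * x 0 + q t * x 1) ∧
      (∀ t ∈ Icc a b, DifferentiableAt ℝ p t) ∧ (∀ t ∈ Icc a b, DifferentiableAt ℝ q t) := by
    refine ⟨fun t => -Real.sin t + Real.cos t * μ t, fun t => Real.cos t + Real.sin t * μ t,
      fun t x => by rw [hproj]; ring, fun t ht => ?_, fun t ht => ?_⟩
    · have := hμd t ht
      fun_prop
    · have := hμd t ht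
      fun_prop
  have hderiv : ∀ t ∈ Icc a b, ∀ x, deriv (fun s => scalarProj P s x) t =
      deriv p t * x 0 + deriv q t * x 1 := by
    intro t ht x
    simp only [hpq]
    exact (((hpd t ht).hasDerivAt.mul_const _).add ((hqd t ht).hasDerivAt.mul_const _)).deriv
  obtain ⟨C₀, hC₀, hhol⟩ := hP2
  have hholR : ∀ Z : ℝ, 0 < Z → ∀ z : ℝ², ‖z‖ ≤ Z → ∀ t₁ ∈ Icc a b, ∀ t₂ ∈ Icc a b,
      |deriv (fun s => scalarProj P s z) t₁ - deriv (fun s => scalarProj P s z) t₂| ≤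
        C₀ * Z / r * |t₁ - t₂| ^ δ := by
    intro Z hZ z hz t₁ h₁ t₂ h₂
    have hmem : (r / Z) • z ∈ closedBall (0 : ℝ²) r := by
      rw [mem_closedBall_zero_iff, norm_smul, Real.norm_of_nonneg (by positivity)]
      calc r / Z * ‖z‖ ≤ r / Z * Z := by gcongr
        _ = r := by field_simp
    have h := hhol _ hmem t₁ h₁ t₂ h₂
    simp only [hderiv _ h₁, hderiv _ h₂, PiLp.smul_apply, smul_eq_mul] at h ⊢
    have e : deriv p t₁ * (r / Z * z 0) + deriv q t₁ * (r / Z * z 1) -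
        (deriv p t₂ * (r / Z * z 0) + deriv q t₂ * (r / Z * z 1)) =
        (r / Z) * (deriv p t₁ * z 0 + deriv q t₁ * z 1 -
          (deriv p t₂ * z 0 + deriv q t₂ * z 1)) := by ring
    rw [e, abs_mul, abs_of_pos (by positivity : 0 < r / Z), ← le_div_iff₀' (by positivity)] at h
    refine h.trans_eq ?_
    field_simp
  have hpc : ContinuousOn (deriv p) (Icc a b) := by
    refine continuousOn_of_abs_sub_le_rpow (C := C₀ * 1 / r) hδ0 fun t₁ h₁ t₂ h₂ => ?_
    have h := hholR 1 one_pos (mk2 1 0) (by simp [EuclideanSpace.norm_eq]) t₁ h₁ t₂ h₂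
    simpa [hderiv _ h₁, hderiv _ h₂] using h
  have hqc : ContinuousOn (deriv q) (Icc a b) := by
    refine continuousOn_of_abs_sub_le_rpow (C := C₀ * 1 / r) hδ0 fun t₁ h₁ t₂ h₂ => ?_
    have h := hholR 1 one_pos (mk2 0 1) (by simp [EuclideanSpace.norm_eq]) t₁ h₁ t₂ h₂
    simpa [hderiv _ h₁, hderiv _ h₂] using h
  have hDc : ContinuousOn (fun u : ℝ × ℝ² => deriv p u.1 * u.2 0 + deriv q u.1 * u.2 1)
      (Icc a b ×ˢ univ) := by
    have h1 := hpc.comp (continuousOn_fst (s := Icc a b ×ˢ (univ : Set ℝ²))) fun u hu => hu.1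
    have h2 := hqc.comp (continuousOn_fst (s := Icc a b ×ˢ (univ : Set ℝ²))) fun u hu => hu.1
    exact (h1.mul (by fun_prop)).add (h2.mul (by fun_prop))
  have hprojc : ContinuousOn (fun u : ℝ × ℝ² => p u.1 * u.2 0 + q u.1 * u.2 1)
      (Icc a b ×ˢ univ) := by
    have hp : ContinuousOn p (Icc a b) := fun t ht => (hpd t ht).continuousAt.continuousWithinAt
    have hq : ContinuousOn q (Icc a b) := fun t ht => (hqd t ht).continuousAt.continuousWithinAt
    have h1 := hp.comp (continuousOn_fst (s := Icc a b ×ˢ (univ : Set ℝ²))) fun u hu => hu.1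
    have h2 := hq.comp (continuousOn_fst (s := Icc a b ×ˢ (univ : Set ℝ²))) fun u hu => hu.1
    exact (h1.mul (by fun_prop)).add (h2.mul (by fun_prop))
  have hbound : ∀ K : Set ℝ², IsCompact K → ∃ M : ℝ, 0 < M ∧ ∀ t ∈ Icc a b, ∀ x ∈ K,
      |deriv (fun s => scalarProj P s x) t| ≤ M := by
    intro K hK
    obtain ⟨M, hM⟩ := (isCompact_Icc.prod hK).exists_bound_of_continuousOn
      (hDc.mono (prod_mono_right (subset_univ K)))
    refine ⟨max M 1, by positivity, fun t ht x hx => ?_⟩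
    rw [hderiv t ht]
    exact (hM (t, x) ⟨ht, hx⟩).trans (le_max_left _ _)
  refine ⟨fun I hI _ => ?_, ?_⟩
  · obtain ⟨M, hM0, hM⟩ := hbound _ (isCompact_closedBall (0 : ℝ²) r)
    have hIc : ∀ t ∈ I, t ∈ Icc a b := fun t ht => Ioo_subset_Icc_self (hI ht)
    refine ⟨max M C₀, lt_max_of_lt_left hM0,
      fun t ht x hx => (hM t (hIc t ht) x hx).trans (le_max_left _ _),
      fun x hx t₁ h₁ t₂ h₂ => (hhol x hx t₁ (hIc _ h₁) t₂ (hIc _ h₂)).trans ?_⟩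
    gcongr
    exact le_max_right _ _
  have hS : IsCompact (range γ) :=
    Function.Periodic.compact_of_continuous hγ_per hL.ne' hγ_C2.continuous
  obtain ⟨⟨t₀, z₀⟩, hu₀, hmin⟩ := (isCompact_Icc.prod hS).exists_isMinOn
    ((nonempty_Icc.mpr hab.le).prod (range_nonempty γ))
    ((hprojc.abs.add hDc.abs).mono (prod_mono_right (subset_univ (range γ))))
  obtain ⟨c, hc0, hc⟩ : ∃ c : ℝ, 0 < c ∧ ∀ t ∈ Icc a b, ∀ z, N z = 1 →
      c ≤ |scalarProj P t z| + |deriv (fun s => scalarProj P s z) t| := by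
    refine ⟨|p t₀ * z₀ 0 + q t₀ * z₀ 1| + |deriv p t₀ * z₀ 0 + deriv q t₀ * z₀ 1|, ?_,
      fun t ht z hz => ?_⟩
    · have hz : N z₀ = 1 := by
        have := hu₀.2
        rwa [hγ_range] at this
      have h3 := hP3 t₀ hu₀.1 z₀ hz
      rw [hpq, hderiv t₀ hu₀.1] at h3
      by_cases h : p t₀ * z₀ 0 + q t₀ * z₀ 1 = 0
      · exact add_pos_of_nonneg_of_pos (abs_nonneg _) (abs_pos.mpr (h3 h))
      · exact add_pos_of_pos_of_nonneg (abs_pos.mpr h) (abs_nonneg _)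
    · rw [hpq, hderiv t ht]
      exact hmin (a := (t, z)) ⟨ht, by rw [hγ_range]; exact hz⟩
  have hquot : ∀ x y : ℝ², x ≠ y → ∃ z, N z = 1 ∧ ∀ s, projQuot N P s x y = scalarProj P s z := by
    intro x y hxy
    have hn := hN_pos (x - y) (sub_ne_zero.mpr hxy)
    refine ⟨(N (x - y))⁻¹ • (x - y), ?_, fun s => ?_⟩
    · rw [hN_smul, abs_of_pos (inv_pos.mpr hn), inv_mul_cancel₀ hn.ne']
    · simp only [projQuot, hpq, PiLp.smul_apply, PiLp.sub_apply, smul_eq_mul]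
      field_simp
      ring
  refine ⟨c / 2, by positivity, ?_, ?_⟩
  · intro x _ y _ hxy t ht hle
    obtain ⟨z, hz, hzs⟩ := hquot x y hxy
    simp only [hzs] at hle ⊢
    linarith [hc t (Ioo_subset_Icc_self ht) z hz]
  · obtain ⟨M, hM0, hM⟩ := hbound _ hS
    obtain ⟨Z, hZ0, hZ⟩ := hS.isBounded.exists_pos_norm_le
    refine ⟨M, hM0, C₀ * Z / r, by positivity, ?_⟩
    intro x _ y _ hxy t₁ h₁ t₂ h₂ _
    obtain ⟨z, hz, hzs⟩ := hquot x y hxy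
    have hzγ : z ∈ range γ := by rw [hγ_range]; exact hz
    simp only [hzs]
    exact ⟨hM t₁ (Ioo_subset_Icc_self h₁) z hzγ,
      hholR Z hZ0 z (hZ z hzγ) t₁ (Ioo_subset_Icc_self h₁) t₂ (Ioo_subset_Icc_self h₂)⟩
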